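/- arXiv:1907.09047 — 2 statements merged into one kernel-verified Lean document; each statement's English description precedes it below -/
import Mathlib

section
/- Let n ≥ 1, let F_q be a finite field with q elements, let P, Q ∈ Pos(n), and let σ be a permutation of Fin n. Then the number of left cosets of I*([QP]_σ;F_q) in I*(Q;F_q) equals q^{inv_{Q,P}(σ)}, where inv_{Q,P}(σ) := |{(i,j) : i < j, i <_Q j, and ¬(σ⁻¹(i) <_P σ⁻¹(j))}|. -/
open Matrix in
/-- The group of invertible matrices over a finite field supported on a reflexive and transitive
relation. -/
def incidenceSubgroup {n : ℕ} (F : Type*) [Field F] [Finite F] (R : Fin n → Fin n → Prop)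
    (hrefl : ∀ i, R i i) (htrans : ∀ i j k, R i j → R j k → R i k) :
    Subgroup (GL (Fin n) F) :=
  let M : Submonoid (GL (Fin n) F) :=
    { carrier := {A | ∀ i j, ¬ R i j → (A : Matrix (Fin n) (Fin n) F) i j = 0}
      one_mem' := by
        intro i j h
        have hij : i ≠ j := by
          rintro rfl
          exact h (hrefl i)
        simp [hij]
      mul_mem' := by
        intro A B hA hB i j h
        rw [Units.val_mul, Matrix.mul_apply]
        refine Finset.sum_eq_zero fun k _ => ?_
        by_cases hik : R i k
        · rw [hB k j fun hkj => h (htrans i k j hik hkj), mul_zero]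
        · rw [hA i k hik, zero_mul] }
  { M with
    inv_mem' := by
      intro A hA
      have h : A⁻¹ ∈ Submonoid.powers A := by
        rw [mem_powers_iff_mem_zpowers]
        exact inv_mem (Subgroup.mem_zpowers A)
      exact (Submonoid.powers_le.2 (show A ∈ M from hA)) h }

theorem mem_incidenceSubgroup {n : ℕ} {F : Type*} [Field F] [Finite F]
    {R : Fin n → Fin n → Prop} {hrefl : ∀ i, R i i}
    {htrans : ∀ i j k, R i j → R j k → R i k} {A : Matrix.GeneralLinearGroup (Fin n) F} :
    A ∈ incidenceSubgroup F R hrefl htrans ↔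
      ∀ i j, ¬ R i j → (A : Matrix (Fin n) (Fin n) F) i j = 0 :=
  Iff.rfl

open Classical in
/-- The matrix with prescribed diagonal and prescribed entries at the strict pairs of a relation. -/
noncomputable def incidenceMatrix {n : ℕ} {F : Type*} [Field F] (R : Fin n → Fin n → Prop)
    (d : Fin n → Fˣ) (f : {p : Fin n × Fin n // p.1 < p.2 ∧ R p.1 p.2} → F) :
    Matrix (Fin n) (Fin n) F :=
  Matrix.of fun i j =>
    if i = j then (d i : F) else if h : i < j ∧ R i j then f ⟨(i, j), h⟩ else 0

theorem det_incidenceMatrix {n : ℕ} {F : Type*} [Field F] (R : Fin n → Fin n → Prop)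
    (d : Fin n → Fˣ) (f : {p : Fin n × Fin n // p.1 < p.2 ∧ R p.1 p.2} → F) :
    (incidenceMatrix R d f).det = ∏ i, (d i : F) := by
  rw [Matrix.det_of_isUpperTriangular]
  · simp [incidenceMatrix]
  · intro i j hij
    have hij : j < i := hij
    simp [incidenceMatrix, hij.ne', hij.not_gt]

/-- An invertible matrix supported on a relation refining the natural order is determined by its
nonzero diagonal entries and its arbitrary entries at the strict pairs. -/
noncomputable def incidenceSubgroupEquiv {n : ℕ} (F : Type*) [Field F] [Finite F]
    (R : Fin n → Fin n → Prop) (hrefl : ∀ i, R i i)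
    (htrans : ∀ i j k, R i j → R j k → R i k) (hnat : ∀ i j, R i j → i ≤ j) :
    (Fin n → Fˣ) × ({p : Fin n × Fin n // p.1 < p.2 ∧ R p.1 p.2} → F) ≃
      incidenceSubgroup F R hrefl htrans where
  toFun x := ⟨Matrix.GeneralLinearGroup.mkOfDetNeZero (incidenceMatrix R x.1 x.2) (by
      rw [det_incidenceMatrix]
      exact Finset.prod_ne_zero_iff.2 fun i _ => (x.1 i).ne_zero), by
    rw [mem_incidenceSubgroup]
    intro i j h
    have hij : i ≠ j := by
      rintro rfl
      exact h (hrefl i)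
    simp [Matrix.GeneralLinearGroup.mkOfDetNeZero, incidenceMatrix, hij, h]⟩
  invFun A :=
    (fun i => Units.mk0 ((A.1 : Matrix (Fin n) (Fin n) F) i i) (by
      have hdet : (A.1 : Matrix (Fin n) (Fin n) F).det ≠ 0 :=
        ((Matrix.isUnit_iff_isUnit_det _).1 A.1.isUnit).ne_zero
      rw [Matrix.det_of_isUpperTriangular] at hdet
      · exact Finset.prod_ne_zero_iff.1 hdet i (Finset.mem_univ i)
      · intro i j hij
        exact mem_incidenceSubgroup.1 A.2 i j fun h => (hnat i j h).not_gt hij),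
     fun p => (A.1 : Matrix (Fin n) (Fin n) F) p.1.1 p.1.2)
  left_inv := by
    rintro ⟨d, f⟩
    ext i
    · simp [Matrix.GeneralLinearGroup.mkOfDetNeZero, incidenceMatrix]
    · obtain ⟨⟨a, b⟩, h⟩ := i
      simp [Matrix.GeneralLinearGroup.mkOfDetNeZero, incidenceMatrix, h.1.ne, h.1, h.2]
  right_inv := by
    intro A
    ext i j
    by_cases hij : i = j
    · subst hij
      simp [Matrix.GeneralLinearGroup.mkOfDetNeZero, incidenceMatrix]
    · by_cases h : R i j
      · simp [Matrix.GeneralLinearGroup.mkOfDetNeZero, incidenceMatrix, hij, h,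
          lt_of_le_of_ne (hnat i j h) hij]
      · simp [Matrix.GeneralLinearGroup.mkOfDetNeZero, incidenceMatrix, hij, h,
          mem_incidenceSubgroup.1 A.2 i j h]

theorem card_incidenceSubgroup {n : ℕ} (F : Type*) [Field F] [Finite F]
    (R : Fin n → Fin n → Prop) (hrefl : ∀ i, R i i)
    (htrans : ∀ i j k, R i j → R j k → R i k) (hnat : ∀ i j, R i j → i ≤ j) :
    Nat.card (incidenceSubgroup F R hrefl htrans) =
      Nat.card Fˣ ^ n *
        Nat.card F ^ Nat.card {p : Fin n × Fin n // p.1 < p.2 ∧ R p.1 p.2} := by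
  rw [← Nat.card_congr (incidenceSubgroupEquiv F R hrefl htrans hnat), Nat.card_prod,
    Nat.card_fun, Nat.card_fun, Nat.card_fin]

/-- The left cosets of `H` with a representative in `K`, as subsets of the ambient group, are
counted by the relative index. -/
theorem card_leftCosets_eq_relIndex {G : Type*} [Group G] (H K : Subgroup G) :
    Nat.card {S : Set G // ∃ b, b ∈ K ∧ S = {c | ∃ x, x ∈ H ∧ c = b * x}} =
      H.relIndex K := by
  have key (a b : G) :
      {c | ∃ x, x ∈ H ∧ c = a * x} = {c | ∃ x, x ∈ H ∧ c = b * x} ↔ a⁻¹ * b ∈ H := by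
    have hset (a : G) : {c | ∃ x, x ∈ H ∧ c = a * x} = {c | a⁻¹ * c ∈ H} := by
      ext c
      constructor
      · rintro ⟨x, hx, rfl⟩
        simpa using hx
      · intro hc
        exact ⟨a⁻¹ * c, hc, by simp⟩
    rw [hset, hset]
    constructor
    · intro h
      have hb : b ∈ {c | b⁻¹ * c ∈ H} := by simp [H.one_mem]
      rw [← h] at hb
      exact hb
    · intro h
      ext c
      have hc : a⁻¹ * c = a⁻¹ * b * (b⁻¹ * c) := by group
      simp only [Set.mem_ofPred_eq]
      rw [hc, H.mul_mem_cancel_left h]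
  symm
  refine Nat.card_congr (Equiv.ofBijective (Quotient.lift
    (fun b : K => (⟨{c | ∃ x, x ∈ H ∧ c = (b : G) * x}, b, b.2, rfl⟩ :
      {S : Set G // ∃ b, b ∈ K ∧ S = {c | ∃ x, x ∈ H ∧ c = b * x}})) ?_) ⟨?_, ?_⟩)
  · intro a b h
    have h' := QuotientGroup.leftRel_apply.1 h
    exact Subtype.ext ((key a b).2 (Subgroup.mem_subgroupOf.1 h'))
  · rintro ⟨a⟩ ⟨b⟩ h
    refine Quotient.sound (QuotientGroup.leftRel_apply.2 ?_)
    exact Subgroup.mem_subgroupOf.2 ((key a b).1 (Subtype.ext_iff.1 h))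
  · rintro ⟨S, b, hb, rfl⟩
    exact ⟨Quotient.mk _ ⟨b, hb⟩, rfl⟩

/-- Over a finite field with `q` elements, the number of left
cosets of `I*([QP]_σ;F_q)` in `I*(Q;F_q)` equals `q^{inv_{Q,P}(σ)}`, where
`inv_{Q,P}(σ) = |{(i,j) : i < j, i <_Q j, ¬(σ⁻¹(i) <_P σ⁻¹(j))}|`. -/
theorem stmt_6 (n : ℕ) (hn : 1 ≤ n) (q : ℕ) (F : Type*) [Field F] [Fintype F]
    (hq : Fintype.card F = q)
    (leP leQ : Fin n → Fin n → Prop)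
    (hPrefl : ∀ i, leP i i) (hPtrans : ∀ i j k, leP i j → leP j k → leP i k)
    (hPnat : ∀ i j, leP i j → i ≤ j)
    (hQrefl : ∀ i, leQ i i) (hQtrans : ∀ i j k, leQ i j → leQ j k → leQ i k)
    (hQnat : ∀ i j, leQ i j → i ≤ j)
    (σ : Equiv.Perm (Fin n)) :
    Nat.card {S : Set (Matrix.GeneralLinearGroup (Fin n) F) //
        ∃ B : Matrix.GeneralLinearGroup (Fin n) F,
          (∀ i j, ¬ leQ i j → (B : Matrix (Fin n) (Fin n) F) i j = 0) ∧
          S = {C | ∃ X : Matrix.GeneralLinearGroup (Fin n) F,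
            (∀ i j, ¬ (leQ i j ∧ leP (σ.symm i) (σ.symm j)) →
              (X : Matrix (Fin n) (Fin n) F) i j = 0) ∧ C = B * X}}
      = q ^ (Nat.card {p : Fin n × Fin n //
          p.1 < p.2 ∧ (leQ p.1 p.2 ∧ p.1 ≠ p.2) ∧
            ¬ (leP (σ.symm p.1) (σ.symm p.2) ∧ σ.symm p.1 ≠ σ.symm p.2)}) := by
  subst hq
  let R : Fin n → Fin n → Prop := fun i j => leQ i j ∧ leP (σ.symm i) (σ.symm j)
  have hRrefl : ∀ i, R i i := fun i => ⟨hQrefl i, hPrefl _⟩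
  have hRtrans : ∀ i j k, R i j → R j k → R i k := fun i j k hij hjk =>
    ⟨hQtrans i j k hij.1 hjk.1, hPtrans _ _ _ hij.2 hjk.2⟩
  let H := incidenceSubgroup F R hRrefl hRtrans
  let K := incidenceSubgroup F leQ hQrefl hQtrans
  have hHK : H ≤ K := fun A hA => mem_incidenceSubgroup.2 fun i j hij =>
    mem_incidenceSubgroup.1 hA i j fun h => hij h.1
  refine (card_leftCosets_eq_relIndex H K).trans ?_
  have hpairs : Nat.card {p : Fin n × Fin n // p.1 < p.2 ∧ leQ p.1 p.2} =
      Nat.card {p : Fin n × Fin n // p.1 < p.2 ∧ (leQ p.1 p.2 ∧ p.1 ≠ p.2) ∧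
        ¬ (leP (σ.symm p.1) (σ.symm p.2) ∧ σ.symm p.1 ≠ σ.symm p.2)} +
      Nat.card {p : Fin n × Fin n // p.1 < p.2 ∧ R p.1 p.2} := by
    classical
    simp only [Nat.card_eq_fintype_card, Fintype.card_subtype]
    rw [← Finset.card_union_of_disjoint]
    · congr 1
      ext ⟨i, j⟩
      have hne : i < j → i ≠ j := ne_of_lt
      simp only [Finset.mem_filter, Finset.mem_univ, true_and, Finset.mem_union, R, ne_eq,
        EmbeddingLike.apply_eq_iff_eq]
      tauto
    · rw [Finset.disjoint_left]
      rintro ⟨i, j⟩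
      simp only [Finset.mem_filter, Finset.mem_univ, true_and, R, ne_eq,
        EmbeddingLike.apply_eq_iff_eq]
      tauto
  have hcard : H.relIndex K * Nat.card H = Nat.card K := by
    simpa only [Subgroup.relIndex_bot_left, mul_comm] using
      Subgroup.relIndex_mul_relIndex ⊥ H K bot_le hHK
  rw [card_incidenceSubgroup F R hRrefl hRtrans fun i j h => hQnat i j h.1,
    card_incidenceSubgroup F leQ hQrefl hQtrans hQnat, hpairs, pow_add,
    mul_left_comm (Nat.card Fˣ ^ n)] at hcard
  rw [← Nat.card_eq_fintype_card]
  exact Nat.eq_of_mul_eq_mul_right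
    (Nat.mul_pos (pow_pos Nat.card_pos _) (pow_pos Nat.card_pos _)) hcard
end

section
/- Let n ≥ 1, F a field, Q ∈ Pos(n), and let v, w : Fin n → F be two nonzero vectors. Then there exists an invertible matrix A with A i j = 0 whenever ¬(i ≤_Q j) and A·v = w if and only if the lower closures, with respect to ≤_Q, of the supports {i : v i ≠ 0} and {i : w i ≠ 0} coincide. Consequently, the orbits of the action of I*(Q;F) on the projective space P(F^n) are exactly the sets Q_I = {[v] : the ≤_Q-lower closure of the support of v equals I}, one for each nonempty order ideal I of Q. -/
open Matrix

/-- A matrix supported on a relation refining the natural order has determinant equal to the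
product of its diagonal entries. -/
lemma det_eq_prod_diag_of_incidence {n : ℕ} {F : Type*} [Field F] {leQ : Fin n → Fin n → Prop}
    (hQnat : ∀ i j, leQ i j → i ≤ j) {A : Matrix (Fin n) (Fin n) F}
    (hA : ∀ i j, ¬ leQ i j → A i j = 0) : A.det = ∏ i, A i i :=
  det_of_isUpperTriangular fun i j hij => hA i j fun h => (hQnat i j h).not_gt hij

/-- The support of `A *ᵥ v` lies in the lower closure of the support of `v`. -/
lemma exists_le_of_mulVec_ne_zero {n : ℕ} {F : Type*} [Field F] {leQ : Fin n → Fin n → Prop}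
    {A : Matrix (Fin n) (Fin n) F} (hA : ∀ i j, ¬ leQ i j → A i j = 0)
    {v : Fin n → F} {i : Fin n} (hi : (A *ᵥ v) i ≠ 0) : ∃ k, v k ≠ 0 ∧ leQ i k := by
  simp only [mulVec, dotProduct] at hi
  obtain ⟨k, -, hk⟩ := Finset.exists_ne_zero_of_sum_ne_zero hi
  exact ⟨k, right_ne_zero_of_mul hk, by_contra fun h => left_ne_zero_of_mul hk (hA i k h)⟩

/-- If the diagonal of `A` does not vanish, the support of `v` lies in the lower closure of the
support of `A *ᵥ v`. -/
lemma exists_le_mulVec_ne_zero {n : ℕ} {F : Type*} [Field F] {leQ : Fin n → Fin n → Prop}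
    (hQrefl : ∀ i, leQ i i) (hQtrans : ∀ i j k, leQ i j → leQ j k → leQ i k)
    (hQnat : ∀ i j, leQ i j → i ≤ j) {A : Matrix (Fin n) (Fin n) F}
    (hA : ∀ i j, ¬ leQ i j → A i j = 0) (hdiag : ∀ i, A i i ≠ 0)
    {v : Fin n → F} {i : Fin n} (hi : v i ≠ 0) : ∃ k, (A *ᵥ v) k ≠ 0 ∧ leQ i k := by
  obtain ⟨m, ⟨hm, him⟩, hmax⟩ :=
    (Set.toFinite {k | v k ≠ 0 ∧ leQ i k}).exists_maximal ⟨i, hi, hQrefl i⟩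
  refine ⟨m, ?_, him⟩
  have key : (A *ᵥ v) m = A m m * v m := by
    simp only [mulVec, dotProduct]
    refine Finset.sum_eq_single m (fun k _ hkm => ?_) (by simp)
    by_contra hk
    have hmk : leQ m k := by_contra fun h => left_ne_zero_of_mul hk (hA m k h)
    exact hkm (le_antisymm
      (hmax ⟨right_ne_zero_of_mul hk, hQtrans i m k him hmk⟩ (hQnat m k hmk)) (hQnat m k hmk))
  rw [key]
  exact mul_ne_zero (hdiag m) hm

/-- When the supports of `v` and `w` have the same lower closure, each coordinate of `w` is the
pairing of `v` with a row supported above that coordinate and nonzero there. -/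
lemma exists_row_of_lowerClosure_eq {n : ℕ} {F : Type*} [Field F] {leQ : Fin n → Fin n → Prop}
    (hQrefl : ∀ i, leQ i i) (hQtrans : ∀ i j k, leQ i j → leQ j k → leQ i k)
    (hQnat : ∀ i j, leQ i j → i ≤ j) {v w : Fin n → F}
    (h : {j | ∃ i, v i ≠ 0 ∧ leQ j i} = {j | ∃ i, w i ≠ 0 ∧ leQ j i}) (i : Fin n) :
    ∃ r : Fin n → F, (∀ j, ¬ leQ i j → r j = 0) ∧ r i ≠ 0 ∧ r ⬝ᵥ v = w i := by
  have hclosure (j : Fin n) : (∃ k, v k ≠ 0 ∧ leQ j k) ↔ ∃ k, w k ≠ 0 ∧ leQ j k :=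
    Set.ext_iff.mp h j
  have of_strictly_above (hm : ∃ m, m ≠ i ∧ leQ i m ∧ v m ≠ 0) :
      ∃ r : Fin n → F, (∀ j, ¬ leQ i j → r j = 0) ∧ r i ≠ 0 ∧ r ⬝ᵥ v = w i := by
    obtain ⟨m, hmi, him, hvm⟩ := hm
    refine ⟨Pi.single i 1 + Pi.single m ((w i - v i) / v m), fun j hj => ?_, ?_, ?_⟩
    · have hji : j ≠ i := fun e => hj (e ▸ hQrefl i)
      have hjm : j ≠ m := fun e => hj (e ▸ him)
      simp [hji, hjm]
    · simp [hmi.symm]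
    · simp [add_dotProduct, hvm]
  by_cases hv : v i = 0
  · by_cases hw : w i = 0
    · refine ⟨Pi.single i 1, fun j hj => ?_, by simp, by simp [hv, hw]⟩
      have hji : j ≠ i := fun e => hj (e ▸ hQrefl i)
      simp [hji]
    · obtain ⟨m, hvm, him⟩ := (hclosure i).mpr ⟨i, hw, hQrefl i⟩
      exact of_strictly_above ⟨m, fun e => hvm (e ▸ hv), him, hvm⟩
  · by_cases hw : w i = 0
    · obtain ⟨k, hwk, hik⟩ := (hclosure i).mp ⟨i, hv, hQrefl i⟩
      obtain ⟨m, hvm, hkm⟩ := (hclosure k).mpr ⟨k, hwk, hQrefl k⟩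
      have hki : k ≠ i := fun e => hwk (e ▸ hw)
      refine of_strictly_above ⟨m, fun e => hki ?_, hQtrans i k m hik hkm, hvm⟩
      exact le_antisymm (e ▸ hQnat k m hkm) (hQnat i k hik)
    · refine ⟨Pi.single i (w i / v i), fun j hj => ?_, by simp [hv, hw], by simp [hv]⟩
      have hji : j ≠ i := fun e => hj (e ▸ hQrefl i)
      simp [hji]

/-- For nonzero vectors `v, w ∈ F^n`, there is a matrix
`A ∈ I*(Q;F)` with `A·v = w` iff the `≤_Q`-lower closures of the supports of
`v` and `w` coincide.  (This describes the orbits of `I*(Q;F)` on `P(F^n)`: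
they are indexed by the nonempty order ideals of `Q`.) -/
theorem stmt_7 (n : ℕ) (hn : 1 ≤ n) (F : Type*) [Field F]
    (leQ : Fin n → Fin n → Prop)
    (hQrefl : ∀ i, leQ i i) (hQtrans : ∀ i j k, leQ i j → leQ j k → leQ i k)
    (hQnat : ∀ i j, leQ i j → i ≤ j)
    (v w : Fin n → F) (hv : v ≠ 0) (hw : w ≠ 0) :
    (∃ A : Matrix.GeneralLinearGroup (Fin n) F,
        (∀ i j, ¬ leQ i j → (A : Matrix (Fin n) (Fin n) F) i j = 0) ∧
        (A : Matrix (Fin n) (Fin n) F).mulVec v = w)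
      ↔ {j | ∃ i, v i ≠ 0 ∧ leQ j i} = {j | ∃ i, w i ≠ 0 ∧ leQ j i} := by
  constructor
  · rintro ⟨A, hA, rfl⟩
    have hdiag (i : Fin n) : (A : Matrix (Fin n) (Fin n) F) i i ≠ 0 := by
      have hdet := ((isUnit_iff_isUnit_det _).mp A.isUnit).ne_zero
      rw [det_eq_prod_diag_of_incidence hQnat hA] at hdet
      exact Finset.prod_ne_zero_iff.mp hdet i (Finset.mem_univ i)
    ext j
    constructor
    · rintro ⟨i, hi, hji⟩
      obtain ⟨k, hk, hik⟩ := exists_le_mulVec_ne_zero hQrefl hQtrans hQnat hA hdiag hi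
      exact ⟨k, hk, hQtrans j i k hji hik⟩
    · rintro ⟨i, hi, hji⟩
      obtain ⟨k, hk, hik⟩ := exists_le_of_mulVec_ne_zero hA hi
      exact ⟨k, hk, hQtrans j i k hji hik⟩
  · intro h
    choose A hA hdiag hAv using exists_row_of_lowerClosure_eq hQrefl hQtrans hQnat h
    have hdet : (Matrix.of A).det ≠ 0 := by
      rw [det_eq_prod_diag_of_incidence hQnat (A := Matrix.of A) hA]
      exact Finset.prod_ne_zero_iff.mpr fun i _ => hdiag i
    exact ⟨GeneralLinearGroup.mkOfDetNeZero (Matrix.of A) hdet, hA, funext hAv⟩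
end
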